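/- arXiv:1502.07571 — 11 statements merged into one kernel-verified Lean document; each statement's English description precedes it below -/
import Mathlib

section
/- The Like mechanism is strategy-proof: for every number of agents k, every number of items m, every nonnegative utility function u, every agent i, every bid profile b in which agent i bids sincerely, and every alternative bid b'_i for agent i, the expected utility of agent i under the Like mechanism with profile b is at least the expected utility of agent i under the Like mechanism with profile (b'_i, b_{-i}). -/
open Finset

/-- The set of agents bidding for an item with bid vector `bid`. -/
def bidders {k : ℕ} (bid : Fin k → Bool) : Finset (Fin k) :=
  Finset.univ.filter (fun i => bid i = true)

/-- The number of items among those arriving strictly before item `j`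
that allocation `A` gives to agent `i`. -/
def countsBefore {k m : ℕ} (A : Fin m → Option (Fin k)) (j : Fin m) (i : Fin k) : ℕ :=
  (Finset.univ.filter (fun j' : Fin m => j' < j ∧ A j' = some i)).card

/-- Probability that the Balanced Like mechanism makes decision `a` for a single item
with bid vector `bid`, given that agent `i` currently holds `cnt i` items:
uniform among the bidders holding the fewest items, and `none` iff there is no bidder. -/
def blStep {k : ℕ} (bid : Fin k → Bool) (cnt : Fin k → ℕ) (a : Option (Fin k)) : ℚ :=
  match a with
  | none => if bidders bid = ∅ then 1 else 0
  | some i =>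
      if i ∈ (bidders bid).filter (fun i0 => ∀ i' ∈ bidders bid, cnt i0 ≤ cnt i') then
        (((bidders bid).filter (fun i0 => ∀ i' ∈ bidders bid, cnt i0 ≤ cnt i')).card : ℚ)⁻¹
      else 0

/-- Probability that the Balanced Like mechanism, with bid profile `b` and the items
arriving in the order `0, 1, …, m-1`, produces the allocation `A`. -/
def blProb {k m : ℕ} (b : Fin k → Fin m → Bool) (A : Fin m → Option (Fin k)) : ℚ :=
  ∏ j : Fin m, blStep (fun i => b i j) (countsBefore A j) (A j)

/-- Utility of agent `i` for the set of items that `A` allocates to agent `i'`. -/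
def bundleUtil {k m : ℕ} (u : Fin k → Fin m → ℚ) (A : Fin m → Option (Fin k))
    (i i' : Fin k) : ℚ :=
  ∑ j : Fin m, if A j = some i' then u i j else 0

/-- Expected utility of agent `i` under the Balanced Like mechanism with bid profile `b`. -/
def blEU {k m : ℕ} (u : Fin k → Fin m → ℚ) (b : Fin k → Fin m → Bool) (i : Fin k) : ℚ :=
  ∑ A : Fin m → Option (Fin k), blProb b A * bundleUtil u A i i

/-- The sincere bid profile: bid for exactly the items of positive utility. -/
def sincere {k m : ℕ} (u : Fin k → Fin m → ℚ) : Fin k → Fin m → Bool :=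
  fun i j => decide (0 < u i j)

/-- Number of agents bidding for item `j` under bid profile `b`. -/
def likeQ {k m : ℕ} (b : Fin k → Fin m → Bool) (j : Fin m) : ℕ :=
  (Finset.univ.filter (fun i => b i j = true)).card

/-- Expected utility of agent `i` under the Like mechanism with bid profile `b`. -/
def likeEU {k m : ℕ} (u : Fin k → Fin m → ℚ) (b : Fin k → Fin m → Bool) (i : Fin k) : ℚ :=
  ∑ j : Fin m, if b i j then u i j / (likeQ b j : ℚ) else 0

/-- Probability that the Like mechanism with bid profile `b` produces allocation `A`. -/
def likeProb {k m : ℕ} (b : Fin k → Fin m → Bool) (A : Fin m → Option (Fin k)) : ℚ :=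
  ∏ j : Fin m,
    match A j with
    | none => if bidders (fun i => b i j) = ∅ then 1 else 0
    | some i => if b i j then ((likeQ b j : ℚ))⁻¹ else 0

/-- `b` is a pure Nash equilibrium of the Like mechanism. -/
def LikePNE {k m : ℕ} (u : Fin k → Fin m → ℚ) (b : Fin k → Fin m → Bool) : Prop :=
  ∀ (i : Fin k) (b' : Fin m → Bool),
    likeEU u (Function.update b i b') i ≤ likeEU u b i

/-- `b` is a pure Nash equilibrium of the Balanced Like mechanism. -/
def BLPNE {k m : ℕ} (u : Fin k → Fin m → ℚ) (b : Fin k → Fin m → Bool) : Prop :=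
  ∀ (i : Fin k) (b' : Fin m → Bool),
    blEU u (Function.update b i b') i ≤ blEU u b i

/-- `b` is a simple pure Nash equilibrium of the Balanced Like mechanism: every unilateral
deviation either yields strictly less expected utility, or yields equal expected utility
while bidding for at least as many items. -/
def BLSimplePNE {k m : ℕ} (u : Fin k → Fin m → ℚ) (b : Fin k → Fin m → Bool) : Prop :=
  ∀ (i : Fin k) (b' : Fin m → Bool),
    blEU u (Function.update b i b') i < blEU u b i ∨
    (blEU u (Function.update b i b') i = blEU u b i ∧
      (Finset.univ.filter (fun j => b i j = true)).card ≤
        (Finset.univ.filter (fun j => b' j = true)).card)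

/-- Minimum over the (nonempty) set of agents. -/
def minAgents {k : ℕ} (hk : 0 < k) (f : Fin k → ℚ) : ℚ :=
  Finset.univ.inf' (Finset.univ_nonempty_iff.mpr (Fin.pos_iff_nonempty.mp hk)) f

/-- Egalitarian welfare of allocation `A`. -/
def egalAlloc {k m : ℕ} (hk : 0 < k) (u : Fin k → Fin m → ℚ)
    (A : Fin m → Option (Fin k)) : ℚ :=
  minAgents hk (fun i => bundleUtil u A i i)

/-- Utilitarian welfare of allocation `A`. -/
def utilAlloc {k m : ℕ} (u : Fin k → Fin m → ℚ) (A : Fin m → Option (Fin k)) : ℚ :=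
  ∑ i : Fin k, bundleUtil u A i i

/-- Expected (ex post) egalitarian welfare of the Balanced Like mechanism under bids `b`. -/
def blExpEgal {k m : ℕ} (hk : 0 < k) (u : Fin k → Fin m → ℚ)
    (b : Fin k → Fin m → Bool) : ℚ :=
  ∑ A : Fin m → Option (Fin k), blProb b A * egalAlloc hk u A

/-- The number of bidders for item `j` depends only on the bids for item `j`. -/
theorem likeQ_update_of_eq {k m : ℕ} {b : Fin k → Fin m → Bool} {i : Fin k}
    {b' : Fin m → Bool} {j : Fin m} (h : b' j = b i j) :
    likeQ (Function.update b i b') j = likeQ b j := by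
  have hbid (l : Fin k) : Function.update b i b' l j = b l j := by
    obtain rfl | hl := eq_or_ne l i
    · simpa using h
    · rw [Function.update_of_ne hl]
  simp only [likeQ, hbid]

/-- The Like mechanism is strategy-proof: if agent `i` bids sincerely in profile `b`,
no alternative bid `b'` for agent `i` gives them greater expected utility. -/
theorem like_strategyproof (k m : ℕ) (u : Fin k → Fin m → ℚ)
    (hu : ∀ i j, 0 ≤ u i j) (i : Fin k) (b : Fin k → Fin m → Bool)
    (hsincere : ∀ j, b i j = true ↔ 0 < u i j)
    (b' : Fin m → Bool) :
    likeEU u (Function.update b i b') i ≤ likeEU u b i := by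
  unfold likeEU
  refine Finset.sum_le_sum fun j _ => ?_
  rw [Function.update_self]
  by_cases h : b' j = b i j
  · rw [likeQ_update_of_eq h, h]
  · by_cases hb : b i j = true
    · have hb' : b' j = false := by simpa [hb] using h
      simpa [hb, hb'] using div_nonneg (hu i j) (Nat.cast_nonneg (likeQ b j))
    · have hu0 : u i j = 0 := le_antisymm (not_lt.mp (mt (hsincere j).mpr hb)) (hu i j)
      simp [hu0]
end

section
/- With 2 agents and 0/1 utilities, the Balanced Like mechanism is strategy-proof: for every sequence of items, every agent i of the two agents, every fixed bid of the other agent, and every alternative bid b'_i for agent i, the expected utility of agent i under the Balanced Like mechanism when agent i bids sincerely is at least the expected utility of agent i when agent i bids b'_i. -/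
open Finset

/-- Probability that an agent bidding `x` receives the current item when the other agent
bids `y` and the agent is `d` items ahead of the other agent. -/
def winProb (x y : Bool) (d : ℤ) : ℚ :=
  if x then (if y then (if d < 0 then 1 else if d = 0 then 1 / 2 else 0) else 1) else 0

/-- Probability that nobody receives the current item. -/
def noneProb (x y : Bool) : ℚ := if x || y then 0 else 1

lemma winProb_add_winProb_add_noneProb (x y : Bool) (d : ℤ) :
    winProb x y d + winProb y x (-d) + noneProb x y = 1 := by
  rcases lt_trichotomy d 0 with h | h | h
  · cases x <;> cases y <;> simp [winProb, noneProb, h, h.not_gt, h.ne]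
  · cases x <;> cases y <;> simp [winProb, noneProb, h] <;> norm_num
  · cases x <;> cases y <;> simp [winProb, noneProb, h, h.not_gt, h.ne']

/-- Expected utility of an agent with bids `x` and utilities `w` against an agent
with bids `y`, when the agent starts `d` items ahead. -/
def value : (m : ℕ) → (Fin m → Bool) → (Fin m → Bool) → (Fin m → ℚ) → ℤ → ℚ
  | 0, _, _, _, _ => 0
  | m + 1, x, y, w, d =>
    winProb (x 0) (y 0) d * (w 0 + value m (Fin.tail x) (Fin.tail y) (Fin.tail w) (d + 1)) +
    winProb (y 0) (x 0) (-d) * value m (Fin.tail x) (Fin.tail y) (Fin.tail w) (d - 1) +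
    noneProb (x 0) (y 0) * value m (Fin.tail x) (Fin.tail y) (Fin.tail w) d

lemma blStep_some (bid : Fin 2 → Bool) (c : Fin 2 → ℕ) (i : Fin 2) :
    blStep bid c (some i) = winProb (bid i) (bid (1 - i)) ((c i : ℤ) - c (1 - i)) := by
  have key : (bidders bid).filter (fun i0 => ∀ i' ∈ bidders bid, c i0 ≤ c i') =
      Finset.univ.filter (fun i0 => bid i0 = true ∧ (bid (1 - i0) = true → c i0 ≤ c (1 - i0))) := by
    ext a
    fin_cases a <;> simp [bidders, Fin.forall_fin_two]
  simp only [blStep, key]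
  rcases lt_trichotomy (c 0) (c 1) with h | h | h
  · fin_cases i <;> cases h0 : bid 0 <;> cases h1 : bid 1 <;>
      simp [-Finset.sum_boole, winProb, Finset.card_filter, Fin.sum_univ_two, sub_eq_zero,
        h0, h1, h, h.le, h.not_ge, h.not_gt, h.ne']
  · fin_cases i <;> cases h0 : bid 0 <;> cases h1 : bid 1 <;>
      simp [-Finset.sum_boole, winProb, Finset.card_filter, Fin.sum_univ_two, h0, h1, h]
  · fin_cases i <;> cases h0 : bid 0 <;> cases h1 : bid 1 <;>
      simp [-Finset.sum_boole, winProb, Finset.card_filter, Fin.sum_univ_two, sub_eq_zero,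
        h0, h1, h, h.le, h.not_ge, h.not_gt, h.ne']

lemma blStep_none (bid : Fin 2 → Bool) (c : Fin 2 → ℕ) (i : Fin 2) :
    blStep bid c none = noneProb (bid i) (bid (1 - i)) := by
  simp only [blStep, noneProb, bidders, Finset.filter_eq_empty_iff]
  fin_cases i <;> cases h0 : bid 0 <;> cases h1 : bid 1 <;> simp [Fin.forall_fin_two, h0, h1]

/-- Counts after decision `a`, starting from counts `c`. -/
def addItem {k : ℕ} (c : Fin k → ℕ) (a : Option (Fin k)) (i : Fin k) : ℕ :=
  c i + if a = some i then 1 else 0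

/-- `blProb` for agents who start with `c i` items each. -/
def blProbFrom {k m : ℕ} (b : Fin k → Fin m → Bool) (c : Fin k → ℕ)
    (A : Fin m → Option (Fin k)) : ℚ :=
  ∏ j : Fin m, blStep (fun i => b i j) (fun i => c i + countsBefore A j i) (A j)

lemma countsBefore_cons_zero {k m : ℕ} (a : Option (Fin k)) (A : Fin m → Option (Fin k))
    (i : Fin k) : countsBefore (Fin.cons a A : Fin (m + 1) → Option (Fin k)) 0 i = 0 := by
  simp [countsBefore]

lemma countsBefore_cons_succ {k m : ℕ} (a : Option (Fin k)) (A : Fin m → Option (Fin k))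
    (j : Fin m) (i : Fin k) :
    countsBefore (Fin.cons a A : Fin (m + 1) → Option (Fin k)) j.succ i =
      (if a = some i then 1 else 0) + countsBefore A j i := by
  simp [-Finset.sum_boole, countsBefore, Finset.card_filter, Fin.sum_univ_succ]

lemma blProbFrom_cons {k m : ℕ} (b : Fin k → Fin (m + 1) → Bool) (c : Fin k → ℕ)
    (a : Option (Fin k)) (A : Fin m → Option (Fin k)) :
    blProbFrom b c (Fin.cons a A : Fin (m + 1) → Option (Fin k)) =
      blStep (fun i => b i 0) c a *
        blProbFrom (fun i => Fin.tail (b i)) (addItem c a) A := by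
  simp [blProbFrom, Fin.prod_univ_succ, countsBefore_cons_zero, countsBefore_cons_succ,
    addItem, Fin.tail, add_assoc]

lemma sum_fun_fin_succ {α : Type*} [Fintype α] [DecidableEq α] {m : ℕ}
    (f : (Fin (m + 1) → α) → ℚ) :
    ∑ A, f A = ∑ a : α, ∑ A : Fin m → α, f (Fin.cons a A : Fin (m + 1) → α) := by
  rw [← (Fin.consEquiv (fun _ : Fin (m + 1) => α)).sum_comp, Fintype.sum_prod_type]
  rfl

lemma sum_option_fin_two (f : Option (Fin 2) → ℚ) (i : Fin 2) :
    ∑ a, f a = f (some i) + f (some (1 - i)) + f none := by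
  rw [Fintype.sum_option, Fin.sum_univ_two]
  fin_cases i <;> simp <;> ring

lemma one_sub_one_sub (i : Fin 2) : 1 - (1 - i) = i := sub_sub_cancel 1 i

lemma sum_blProbFrom (m : ℕ) (b : Fin 2 → Fin m → Bool) (c : Fin 2 → ℕ) :
    ∑ A, blProbFrom b c A = 1 := by
  induction m generalizing c with
  | zero => simp [blProbFrom]
  | succ m ih =>
    simp only [sum_fun_fin_succ, blProbFrom_cons, ← Finset.mul_sum, ih, mul_one]
    rw [sum_option_fin_two _ 0, blStep_some, blStep_some, blStep_none _ _ 0, one_sub_one_sub,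
      ← neg_sub (c 0 : ℤ)]
    exact winProb_add_winProb_add_noneProb _ _ _

lemma bundleUtil_cons {k m : ℕ} (u : Fin k → Fin (m + 1) → ℚ) (a : Option (Fin k))
    (A : Fin m → Option (Fin k)) (i : Fin k) :
    bundleUtil u (Fin.cons a A : Fin (m + 1) → Option (Fin k)) i i =
      (if a = some i then u i 0 else 0) + bundleUtil (fun i => Fin.tail (u i)) A i i := by
  simp [bundleUtil, Fin.sum_univ_succ, Fin.tail]

lemma sum_blProbFrom_mul_bundleUtil (m : ℕ) (u : Fin 2 → Fin m → ℚ) (b : Fin 2 → Fin m → Bool)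
    (c : Fin 2 → ℕ) (i : Fin 2) :
    ∑ A, blProbFrom b c A * bundleUtil u A i i =
      value m (b i) (b (1 - i)) (u i) ((c i : ℤ) - c (1 - i)) := by
  induction m generalizing c with
  | zero => simp [bundleUtil, value]
  | succ m ih =>
    have hne : 1 - i ≠ i := by fin_cases i <;> simp
    simp only [sum_fun_fin_succ, blProbFrom_cons, bundleUtil_cons, mul_assoc, mul_add,
      ← Finset.mul_sum, Finset.sum_add_distrib, ← Finset.sum_mul, sum_blProbFrom, one_mul, ih]
    rw [← Finset.sum_add_distrib, sum_option_fin_two _ i, blStep_some, blStep_some,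
      blStep_none _ _ i, one_sub_one_sub, ← neg_sub (c i : ℤ)]
    simp only [value, addItem, Option.some.injEq, hne, hne.symm, if_true, if_false,
      reduceCtorEq, add_zero, Nat.cast_add, Nat.cast_one]
    rw [add_sub_right_comm, ← sub_sub]
    ring

lemma blEU_eq_value {m : ℕ} (u : Fin 2 → Fin m → ℚ) (b : Fin 2 → Fin m → Bool) (i : Fin 2) :
    blEU u b i = value m (b i) (b (1 - i)) (u i) 0 := by
  have h := sum_blProbFrom_mul_bundleUtil m u b (fun _ => 0) i
  simpa [blProbFrom, blEU, blProb] using h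

/-- Utility one for exactly the items that are bid for. -/
def indicatorUtil {m : ℕ} (x : Fin m → Bool) (j : Fin m) : ℚ := if x j then 1 else 0

lemma tail_indicatorUtil {m : ℕ} (x : Fin (m + 1) → Bool) :
    Fin.tail (indicatorUtil x) = indicatorUtil (Fin.tail x) := rfl

/-- Under sincere bids, being ahead by one more item never helps, and being
ahead by two more items costs at most one. -/
lemma value_sincere_bounds (m : ℕ) (x y : Fin m → Bool) (d : ℤ) :
    value m x y (indicatorUtil x) (d + 1) ≤ value m x y (indicatorUtil x) d ∧
    value m x y (indicatorUtil x) (d - 1) ≤ 1 + value m x y (indicatorUtil x) (d + 1) := by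
  induction m generalizing d with
  | zero => simp [value]
  | succ m ih =>
    simp only [value, tail_indicatorUtil]
    generalize hf : value m (Fin.tail x) (Fin.tail y) (indicatorUtil (Fin.tail x)) = f
    have hmono : ∀ d, f (d + 1) ≤ f d := fun d => hf ▸ (ih (Fin.tail x) (Fin.tail y) d).1
    have hlip : ∀ d, f (d - 1) ≤ 1 + f (d + 1) := fun d => hf ▸ (ih (Fin.tail x) (Fin.tail y) d).2
    have m0 := hmono d
    have m1 := hmono (d + 1)
    have m2 := hmono (d - 1)
    have m3 := hmono (d - 1 - 1)
    have l0 := hlip d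
    have l1 := hlip (d + 1)
    have l2 := hlip (d - 1)
    simp only [add_sub_cancel_right, sub_add_cancel] at *
    cases hx : x 0 <;> cases y 0 <;>
      simp only [winProb, noneProb, indicatorUtil, hx, if_true, if_false, Bool.or_true,
        Bool.or_false, Bool.false_eq_true] <;>
      constructor <;> (try split_ifs) <;> first | linarith | (exfalso; omega)

lemma value_le_value_sincere (m : ℕ) (x x' y : Fin m → Bool) (d : ℤ) :
    value m x' y (indicatorUtil x) d ≤ value m x y (indicatorUtil x) d := by
  induction m generalizing d with
  | zero => simp [value]
  | succ m ih =>
    simp only [value, tail_indicatorUtil]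
    have hbd := value_sincere_bounds m (Fin.tail x) (Fin.tail y)
    have i0 := ih (Fin.tail x) (Fin.tail x') (Fin.tail y)
    generalize value m (Fin.tail x) (Fin.tail y) (indicatorUtil (Fin.tail x)) = f at *
    generalize value m (Fin.tail x') (Fin.tail y) (indicatorUtil (Fin.tail x)) = g at *
    have m0 := (hbd d).1
    have m1 := (hbd (d - 1)).1
    have l0 := (hbd d).2
    have g0 := i0 d
    have g1 := i0 (d + 1)
    have g2 := i0 (d - 1)
    simp only [sub_add_cancel] at *
    cases hx : x 0 <;> cases x' 0 <;> cases y 0 <;>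
      simp only [winProb, noneProb, indicatorUtil, hx, if_true, if_false, Bool.or_true,
        Bool.or_false, Bool.false_eq_true] <;>
      (try split_ifs) <;> first | linarith | (exfalso; omega)

/-- With 2 agents and 0/1 utilities, the Balanced Like mechanism is strategy-proof:
for any fixed bid of the other agent, if agent `i` bids sincerely in `b` then no
alternative bid `b'` for agent `i` gives them greater expected utility. -/
theorem balancedLike_two_agents_strategyproof (m : ℕ) (u : Fin 2 → Fin m → ℚ)
    (hu : ∀ i j, u i j = 0 ∨ u i j = 1) (i : Fin 2)
    (b : Fin 2 → Fin m → Bool) (hsincere : ∀ j, b i j = true ↔ 0 < u i j)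
    (b' : Fin m → Bool) :
    blEU u (Function.update b i b') i ≤ blEU u b i := by
  have hui : u i = indicatorUtil (b i) := by
    funext j
    rcases hu i j with h | h
    · have hb : b i j = false := by simpa [h] using hsincere j
      simp [indicatorUtil, h, hb]
    · have hb : b i j = true := by simpa [h] using hsincere j
      simp [indicatorUtil, h, hb]
  have hne : 1 - i ≠ i := by fin_cases i <;> simp
  rw [blEU_eq_value, blEU_eq_value, Function.update_self, Function.update_of_ne hne, hui]
  exact value_le_value_sincere m (b i) b' (b (1 - i)) 0
end

section
/- Memoryless property of the Balanced Like allocation tree for two agents: for every list L of items and all integers x, y, x', y' with x − y = x' − y', one has U1(L,(x,y)) = U1(L,(x',y')). -/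
/-- `U1 L x y` is the expected number of further items that the Balanced Like mechanism
with sincere bids allocates to agent 1, when the remaining items are `L` (each item
recorded as the pair of Booleans saying whether agent 1, resp. agent 2, likes it),
starting from a state where agent 1 holds `x` items and agent 2 holds `y` items. -/
def U1 : List (Bool × Bool) → ℤ → ℤ → ℚ
  | [], _, _ => 0
  | (l1, l2) :: L, x, y =>
    if l1 then
      if l2 then
        if x < y then 1 + U1 L (x + 1) y
        else if y < x then U1 L x (y + 1)
        else (1 + U1 L (x + 1) y) / 2 + (U1 L x (y + 1)) / 2
      else 1 + U1 L (x + 1) y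
    else
      if l2 then U1 L x (y + 1)
      else U1 L x y

/-- Memoryless property of the Balanced Like allocation tree for two agents:
the expected further utility of agent 1 depends only on the difference of the counts. -/
theorem U1_memoryless (L : List (Bool × Bool)) (x y x' y' : ℤ)
    (h : x - y = x' - y') : U1 L x y = U1 L x' y' := by
  induction L generalizing x y x' y' with
  | nil => rfl
  | cons a L ih =>
    obtain ⟨l1, l2⟩ := a
    have hl : U1 L (x + 1) y = U1 L (x' + 1) y' := ih _ _ _ _ (by omega)
    have hr : U1 L x (y + 1) = U1 L x' (y' + 1) := ih _ _ _ _ (by omega)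
    have hlt : x < y ↔ x' < y' := by omega
    have hgt : y < x ↔ y' < x' := by omega
    simp only [U1, hl, hr, hlt, hgt, ih x y x' y' h]
end

section
/- There is an instance with 0/1 utilities where the expected egalitarian welfare of sincere play in the Balanced Like mechanism is strictly greater than the expected egalitarian welfare of every simple pure Nash equilibrium. Concretely, with 3 agents and 3 items a, b, c arriving in this order, where agent 1 has utility 1 for a, b and c, agent 2 has utility 1 for a and c only, and agent 3 has utility 1 for b only, the expected egalitarian welfare of the Balanced Like mechanism under sincere bidding is strictly greater than its expected egalitarian welfare under every simple pure Nash equilibrium of the Balanced Like mechanism. -/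
open Finset

/-- The utility matrix: agent 1 likes `a`, `b`, `c`; agent 2 likes `a`, `c`;
agent 3 likes only `b`. -/
def uEx8 : Fin 3 → Fin 3 → ℚ := ![![1, 1, 1], ![1, 0, 1], ![0, 1, 0]]

/-- Integer utilities of the instance `uEx8`. -/
def natUtil : Fin 3 → Fin 3 → ℕ := ![![1, 1, 1], ![1, 0, 1], ![0, 1, 0]]

theorem uEx8_eq_natUtil (i j : Fin 3) : uEx8 i j = natUtil i j := by
  fin_cases i <;> fin_cases j <;> simp [uEx8, natUtil]

/-- Six times the probability `blStep bid cnt a`, as a natural number. -/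
def stepWeight (bid : Fin 3 → Bool) (cnt : Fin 3 → ℕ) : Option (Fin 3) → ℕ
  | none => if bidders bid = ∅ then 6 else 0
  | some i =>
      if i ∈ (bidders bid).filter (fun i0 => ∀ i' ∈ bidders bid, cnt i0 ≤ cnt i') then
        6 / ((bidders bid).filter (fun i0 => ∀ i' ∈ bidders bid, cnt i0 ≤ cnt i')).card
      else 0

theorem blStep_eq_stepWeight (bid : Fin 3 → Bool) (cnt : Fin 3 → ℕ) (a : Option (Fin 3)) :
    blStep bid cnt a = stepWeight bid cnt a / 6 := by
  cases a with
  | none => by_cases h : bidders bid = ∅ <;> simp [blStep, stepWeight, h]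
  | some i =>
    simp only [blStep, stepWeight]
    generalize (bidders bid).filter (fun i0 => ∀ i' ∈ bidders bid, cnt i0 ≤ cnt i') = W
    split_ifs with h
    · have h_pos : 0 < W.card := Finset.card_pos.mpr ⟨i, h⟩
      have h_le : W.card ≤ 3 := by simpa using W.card_le_univ
      interval_cases W.card <;> norm_num
    · simp

/-- The product `w * t`, which reduces to `0` without evaluating `t` when `w = 0`. -/
def weighted (w t : ℕ) : ℕ := if w = 0 then 0 else w * t

theorem weighted_eq_mul (w t : ℕ) : weighted w t = w * t := by
  by_cases h : w = 0 <;> simp [weighted, h]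

/-- Sum over the possible recipients of an item, written out term by term. -/
def sumRecipients (f : Option (Fin 3) → ℕ) : ℕ :=
  f none + (f (some 0) + f (some 1) + f (some 2))

theorem sumRecipients_eq_sum (f : Option (Fin 3) → ℕ) : sumRecipients f = ∑ a, f a := by
  rw [Fintype.sum_option, Fin.sum_univ_three, sumRecipients]

/-- `216` times the expectation of `g` over the allocations `![x, y, z]` produced by the
Balanced Like mechanism. Branches of probability zero are not explored. -/
def scaledExp (b : Fin 3 → Fin 3 → Bool)
    (g : Option (Fin 3) → Option (Fin 3) → Option (Fin 3) → ℕ) : ℕ :=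
  sumRecipients fun x => weighted (stepWeight (fun i => b i 0) (fun _ => 0) x) <|
    sumRecipients fun y =>
      weighted (stepWeight (fun i => b i 1) (fun i => if x = some i then 1 else 0) y) <|
        sumRecipients fun z =>
          weighted (stepWeight (fun i => b i 2)
            (fun i => (if x = some i then 1 else 0) + if y = some i then 1 else 0) z) (g x y z)

theorem sum_fin_three_fun {α M : Type*} [Fintype α] [AddCommMonoid M] (f : (Fin 3 → α) → M) :
    ∑ A, f A = ∑ x, ∑ y, ∑ z, f ![x, y, z] := by
  simp only [← (Fin.consEquiv fun _ => α).sum_comp, Fintype.sum_prod_type,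
    Fintype.sum_unique]
  rfl

theorem countsBefore_zero (x y z : Option (Fin 3)) :
    countsBefore ![x, y, z] 0 = fun _ => 0 := by
  ext i
  simp [countsBefore]

theorem countsBefore_one (x y z : Option (Fin 3)) :
    countsBefore ![x, y, z] 1 = fun i => if x = some i then 1 else 0 := by
  ext i
  simp only [countsBefore, Finset.card_filter, Fin.sum_univ_three, Matrix.cons_val]
  simp

theorem countsBefore_two (x y z : Option (Fin 3)) :
    countsBefore ![x, y, z] 2 =
      fun i => (if x = some i then 1 else 0) + if y = some i then 1 else 0 := by
  ext i
  simp only [countsBefore, Finset.card_filter, Fin.sum_univ_three, Matrix.cons_val]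
  simp

theorem sum_blProb_mul (b : Fin 3 → Fin 3 → Bool) (f : (Fin 3 → Option (Fin 3)) → ℚ)
    (g : Option (Fin 3) → Option (Fin 3) → Option (Fin 3) → ℕ)
    (hfg : ∀ x y z, f ![x, y, z] = g x y z) :
    ∑ A, blProb b A * f A = scaledExp b g / 216 := by
  simp only [scaledExp, weighted_eq_mul, sumRecipients_eq_sum, sum_fin_three_fun, Nat.cast_sum,
    Nat.cast_mul, Finset.sum_div, Finset.mul_sum]
  refine Finset.sum_congr rfl fun x _ => Finset.sum_congr rfl fun y _ =>
    Finset.sum_congr rfl fun z _ => ?_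
  rw [hfg, blProb, Fin.prod_univ_three, countsBefore_zero, countsBefore_one, countsBefore_two]
  simp only [blStep_eq_stepWeight, Matrix.cons_val]
  ring

/-- Utility of agent `i` in the allocation `![x, y, z]`, as a natural number. -/
def allocUtil (i : Fin 3) (x y z : Option (Fin 3)) : ℕ :=
  (if x = some i then natUtil i 0 else 0) + (if y = some i then natUtil i 1 else 0) +
    if z = some i then natUtil i 2 else 0

theorem bundleUtil_uEx8 (i : Fin 3) (x y z : Option (Fin 3)) :
    bundleUtil uEx8 ![x, y, z] i i = allocUtil i x y z := by
  simp only [bundleUtil, allocUtil, Fin.sum_univ_three, uEx8_eq_natUtil, Matrix.cons_val]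
  push_cast
  rfl

/-- `216` times the expected utility of agent `i`. -/
def scaledEU (b : Fin 3 → Fin 3 → Bool) (i : Fin 3) : ℕ :=
  scaledExp b (allocUtil i)

/-- `216` times the expected egalitarian welfare. -/
def scaledEgal (b : Fin 3 → Fin 3 → Bool) : ℕ :=
  scaledExp b fun x y z => min (allocUtil 0 x y z) (min (allocUtil 1 x y z) (allocUtil 2 x y z))

theorem blEU_uEx8 (b : Fin 3 → Fin 3 → Bool) (i : Fin 3) :
    blEU uEx8 b i = scaledEU b i / 216 :=
  sum_blProb_mul b _ _ (bundleUtil_uEx8 i)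

theorem minAgents_three (hk : 0 < 3) (f : Fin 3 → ℚ) :
    minAgents hk f = min (f 0) (min (f 1) (f 2)) := by
  apply le_antisymm
  · simp only [minAgents, le_min_iff]
    exact ⟨Finset.inf'_le f (mem_univ 0), Finset.inf'_le f (mem_univ 1),
      Finset.inf'_le f (mem_univ 2)⟩
  · refine Finset.le_inf' _ _ fun i _ => ?_
    fin_cases i <;> simp

theorem blExpEgal_uEx8 (hk : 0 < 3) (b : Fin 3 → Fin 3 → Bool) :
    blExpEgal hk uEx8 b = scaledEgal b / 216 :=
  sum_blProb_mul b _ _ fun x y z => by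
    simp only [egalAlloc, minAgents_three, bundleUtil_uEx8, Nat.cast_min]

theorem scaledEgal_sincere : scaledEgal (sincere uEx8) = 162 := by
  decide +kernel

/-- Every bid profile whose welfare is at least that of sincere bidding admits a deviation
that rules it out as a simple pure Nash equilibrium. -/
theorem exists_deviation_of_le_scaledEgal : ∀ b : Fin 3 → Fin 3 → Bool, 162 ≤ scaledEgal b →
    ∃ (i : Fin 3) (b' : Fin 3 → Bool),
      ¬ (scaledEU (Function.update b i b') i < scaledEU b i ∨
        (scaledEU (Function.update b i b') i = scaledEU b i ∧
          (Finset.univ.filter (fun j => b i j = true)).card ≤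
            (Finset.univ.filter (fun j => b' j = true)).card)) := by
  decide +kernel

/-- In the instance `uEx8`, the expected egalitarian welfare of the Balanced Like
mechanism under sincere bidding is strictly greater than its expected egalitarian
welfare under every simple pure Nash equilibrium. -/
theorem sincere_better_than_simple_pne :
    ∀ b : Fin 3 → Fin 3 → Bool, BLSimplePNE uEx8 b →
      blExpEgal (by norm_num) uEx8 b
        < blExpEgal (by norm_num) uEx8 (sincere uEx8) := by
  intro b hb
  rw [blExpEgal_uEx8, blExpEgal_uEx8, scaledEgal_sincere]
  by_contra h
  have h_le : 162 ≤ scaledEgal b := by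
    rw [div_lt_div_iff_of_pos_right (by norm_num), Nat.cast_lt] at h
    exact not_lt.mp h
  obtain ⟨i, b', h_dev⟩ := exists_deviation_of_le_scaledEgal b h_le
  apply h_dev
  have h_pne := hb i b'
  rw [blEU_uEx8, blEU_uEx8, div_lt_div_iff_of_pos_right (by norm_num), Nat.cast_lt,
    div_left_inj' (by norm_num), Nat.cast_inj] at h_pne
  exact h_pne
end

section
/- Supposing agents bid sincerely, the Like mechanism is envy free ex ante: for all agents i and i', the expected utility that agent i assigns to their own random allocated set of items is at least the expected utility that agent i assigns to the random set of items allocated to agent i'. Equivalently, Σ_{j : u(i,j)>0} u(i,j)/q(j) ≥ Σ_{j : u(i',j)>0} u(i,j)/q(j), where q(j) is the number of agents with positive utility for item j. -/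
open Finset

/-- Probability that the Like mechanism makes decision `a` for item `j` under bid profile `b`. -/
def likeStep {k m : ℕ} (b : Fin k → Fin m → Bool) (j : Fin m) (a : Option (Fin k)) : ℚ :=
  match a with
  | none => if bidders (fun i => b i j) = ∅ then 1 else 0
  | some i => if b i j then ((likeQ b j : ℚ))⁻¹ else 0

theorem likeProb_eq_prod_likeStep {k m : ℕ} (b : Fin k → Fin m → Bool)
    (A : Fin m → Option (Fin k)) : likeProb b A = ∏ j, likeStep b j (A j) := rfl

theorem sum_likeStep {k m : ℕ} (b : Fin k → Fin m → Bool) (j : Fin m) :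
    ∑ a, likeStep b j a = 1 := by
  have hq : likeQ b j = (bidders (fun i => b i j)).card := rfl
  simp only [Fintype.sum_option, likeStep, ← Finset.sum_filter, Finset.sum_const, nsmul_eq_mul]
  change _ + ((bidders (fun i => b i j)).card : ℚ) * _ = 1
  by_cases h : bidders (fun i => b i j) = ∅
  · simp [h]
  · have hc : ((bidders (fun i => b i j)).card : ℚ) ≠ 0 := by
      exact_mod_cast Finset.card_ne_zero.mpr (Finset.nonempty_iff_ne_empty.mpr h)
    rw [if_neg h, hq, mul_inv_cancel₀ hc, zero_add]

/-- The marginal of a product of probability weights: the expectation of a function of a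
single coordinate is its expectation under the weight of that coordinate. -/
theorem sum_prod_mul_coordinate {ι α R : Type*} [Fintype ι] [DecidableEq ι] [Fintype α]
    [CommSemiring R] (p : ι → α → R) (hp : ∀ j, ∑ a, p j a = 1) (j : ι) (f : α → R) :
    ∑ A : ι → α, (∏ j', p j' (A j')) * f (A j) = ∑ a, p j a * f a := by
  have hprod : ∀ A : ι → α, (∏ j', p j' (A j')) * f (A j) =
      ∏ j', p j' (A j') * (if j' = j then f (A j') else 1) := fun A => by
    rw [Finset.prod_mul_distrib, Fintype.prod_ite_eq']
  simp_rw [hprod]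
  rw [← Fintype.piFinset_univ,
    ← Finset.prod_univ_sum (fun _ => Finset.univ)
      (fun j' a => p j' a * (if j' = j then f a else 1)),
    Finset.prod_eq_single j]
  · simp
  · intro j' _ hj'
    simp [hj', hp]
  · simp

/-- Agent `i`'s expected utility for the bundle of agent `i'` under the Like mechanism. -/
theorem sum_likeProb_mul_bundleUtil {k m : ℕ} (u : Fin k → Fin m → ℚ)
    (b : Fin k → Fin m → Bool) (i i' : Fin k) :
    ∑ A : Fin m → Option (Fin k), likeProb b A * bundleUtil u A i i' =
      ∑ j ∈ Finset.univ.filter (fun j => b i' j = true), u i j / (likeQ b j : ℚ) := by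
  simp_rw [likeProb_eq_prod_likeStep, bundleUtil, Finset.mul_sum]
  rw [Finset.sum_comm, Finset.sum_filter]
  refine Finset.sum_congr rfl fun j _ => ?_
  rw [sum_prod_mul_coordinate (likeStep b) (sum_likeStep b) j
    (fun a => if a = some i' then u i j else 0)]
  simp only [mul_ite, mul_zero, Finset.sum_ite_eq', Finset.mem_univ, if_true, likeStep,
    ite_mul, zero_mul, div_eq_inv_mul]

/-- Weighting the items by `1 / q j`, agent `i` values the items of positive utility for `i`
at least as much as any other set of items. -/
theorem sum_div_le_sum_pos_div {ι : Type*} [Fintype ι] (v : ι → ℚ) (hv : ∀ j, 0 ≤ v j)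
    (q : ι → ℕ) (s : Finset ι) :
    ∑ j ∈ s, v j / (q j : ℚ) ≤
      ∑ j ∈ Finset.univ.filter (fun j => 0 < v j), v j / (q j : ℚ) := by
  have hnonneg : ∀ j, 0 ≤ v j / (q j : ℚ) := fun j => div_nonneg (hv j) (Nat.cast_nonneg _)
  rw [Finset.sum_filter_of_ne (p := fun j => 0 < v j)]
  · exact Finset.sum_le_univ_sum_of_nonneg hnonneg
  · intro j _ hj
    exact (hv j).lt_of_ne fun h => hj (by rw [← h, zero_div])

/-- With sincere bids, the Like mechanism is envy free ex ante: agent `i`'s expected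
utility for their own random bundle is at least their expected utility for agent `i'`'s
random bundle; equivalently, in terms of the per-item winning probabilities `1/q j`. -/
theorem like_envy_free_ex_ante (k m : ℕ) (u : Fin k → Fin m → ℚ)
    (hu : ∀ i j, 0 ≤ u i j) (i i' : Fin k) :
    (∑ A : Fin m → Option (Fin k), likeProb (sincere u) A * bundleUtil u A i i')
      ≤ (∑ A : Fin m → Option (Fin k), likeProb (sincere u) A * bundleUtil u A i i) ∧
    (∑ j ∈ Finset.univ.filter (fun j => 0 < u i' j),
        u i j / ((Finset.univ.filter (fun i0 => 0 < u i0 j)).card : ℚ))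
      ≤ ∑ j ∈ Finset.univ.filter (fun j => 0 < u i j),
        u i j / ((Finset.univ.filter (fun i0 => 0 < u i0 j)).card : ℚ) := by
  refine ⟨?_, sum_div_le_sum_pos_div (u i) (hu i) _ _⟩
  rw [sum_likeProb_mul_bundleUtil, sum_likeProb_mul_bundleUtil]
  simp only [sincere, decide_eq_true_eq]
  exact sum_div_le_sum_pos_div (u i) (hu i) _ _
end

section
/- The Like mechanism is not bounded envy free ex post, even with 2 agents and 0/1 utilities: for every constant r there exist an instance with 2 agents and 0/1 utilities and an allocation that has positive probability under the Like mechanism with sincere bids, in which agent 2's utility for the set of items allocated to agent 1 exceeds agent 2's utility for their own allocated set by more than r. -/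
open Finset

/-- The Like mechanism is not bounded envy free ex post, even with 2 agents and 0/1
utilities: for every constant `r` there are an instance and an allocation of positive
probability under sincere bids in which agent 2's utility for agent 1's bundle exceeds
agent 2's utility for their own bundle by more than `r`. -/
theorem like_not_bounded_envy_free_ex_post :
    ∀ r : ℚ, ∃ (m : ℕ) (u : Fin 2 → Fin m → ℚ) (A : Fin m → Option (Fin 2)),
      (∀ i j, u i j = 0 ∨ u i j = 1) ∧
      0 < likeProb (sincere u) A ∧
      bundleUtil u A 1 1 + r < bundleUtil u A 1 0 := by
  intro r
  obtain ⟨n, hn⟩ := exists_nat_gt r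
  refine ⟨n, fun _ _ => 1, fun _ => some 0, fun _ _ => Or.inr rfl, ?_, ?_⟩
  · simp [likeProb, likeQ, sincere]
  · simpa [bundleUtil] using hn
end

section
/- Supposing agents bid sincerely and all utilities are 0 or 1, the Balanced Like mechanism is bounded envy free ex post with bound 1: for every allocation having positive probability under the Balanced Like mechanism and all agents i and i', agent i's utility for the set of items allocated to agent i' is at most 1 greater than agent i's utility for their own allocated set. -/
open Finset

/-- A decision of positive probability gives the item to a bidder holding the fewest items. -/
theorem mem_bidders_and_le_of_blStep_ne_zero {k : ℕ} {bid : Fin k → Bool} {cnt : Fin k → ℕ}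
    {a : Fin k} (h : blStep bid cnt (some a) ≠ 0) :
    bid a = true ∧ ∀ i, bid i = true → cnt a ≤ cnt i := by
  by_contra hc
  refine h (if_neg fun hm => hc ?_)
  simpa [bidders] using hm

/-- With 0/1 utilities, the utility of a bundle is the number of its items that are liked. -/
theorem bundleUtil_eq_card {k m : ℕ} {u : Fin k → Fin m → ℚ}
    (hu : ∀ i j, u i j = 0 ∨ u i j = 1) (A : Fin m → Option (Fin k)) (i i' : Fin k) :
    bundleUtil u A i i' = (univ.filter fun j => A j = some i' ∧ u i j = 1).card := by
  rw [bundleUtil, card_filter, Nat.cast_sum]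
  refine sum_congr rfl fun j _ => ?_
  rcases hu i j with h | h <;> simp [h]

/-- With sincere bids and 0/1 utilities, the Balanced Like mechanism is bounded envy
free ex post with bound 1: in every allocation of positive probability, agent `i`'s
utility for agent `i'`'s bundle is at most 1 more than for their own bundle. -/
theorem balancedLike_bounded_envy_free_ex_post (k m : ℕ) (u : Fin k → Fin m → ℚ)
    (hu : ∀ i j, u i j = 0 ∨ u i j = 1)
    (A : Fin m → Option (Fin k)) (hA : 0 < blProb (sincere u) A) (i i' : Fin k) :
    bundleUtil u A i i' ≤ bundleUtil u A i i + 1 := by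
  have hstep (j : Fin m) (a : Fin k) (hj : A j = some a) :
      u a j = 1 ∧ ∀ l, u l j = 1 → countsBefore A j a ≤ countsBefore A j l := by
    have h := prod_ne_zero_iff.mp hA.ne' j (mem_univ j)
    rw [hj] at h
    obtain ⟨hbid, hle⟩ := mem_bidders_and_le_of_blStep_ne_zero h
    refine ⟨(hu a j).resolve_left fun h0 => ?_, fun l hl => hle l ?_⟩
    · simp [sincere, h0] at hbid
    · simp [sincere, hl]
  rw [bundleUtil_eq_card hu, bundleUtil_eq_card hu]
  norm_cast
  rcases (univ.filter fun j => A j = some i' ∧ u i j = 1).eq_empty_or_nonempty with hS | hS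
  · simp [hS]
  obtain ⟨j, hj, hmax⟩ := exists_max_image _ id hS
  have hj' := (mem_filter.mp hj).2
  calc (univ.filter fun j => A j = some i' ∧ u i j = 1).card
      ≤ (insert j (univ.filter fun l => l < j ∧ A l = some i')).card := by
        refine card_le_card fun l hl => ?_
        have hlj : l ≤ j := hmax l hl
        simp only [mem_insert, mem_filter, mem_univ, true_and] at hl ⊢
        exact hlj.eq_or_lt.imp_right fun h => ⟨h, hl.1⟩
    _ ≤ countsBefore A j i' + 1 := card_insert_le _ _
    _ ≤ countsBefore A j i + 1 := Nat.add_le_add_right ((hstep j i' hj'.1).2 i hj'.2) 1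
    _ ≤ (univ.filter fun j => A j = some i ∧ u i j = 1).card + 1 := by
        refine Nat.add_le_add_right (card_le_card fun l hl => ?_) 1
        simp only [mem_filter, mem_univ, true_and] at hl ⊢
        exact ⟨hl.2, (hstep l i hl.2).1⟩
end

section
/- Under the Balanced Like mechanism with k agents and any bid profile b, every agent is guaranteed at least one item for every k items that they bid for: in every allocation having positive probability under the Balanced Like mechanism, each agent i receives at least ⌊t_i / k⌋ items, where t_i is the number of items that agent i bids for. -/
open Finset

/-- In an allocation of positive probability, an item that agent `i` bids for goes to some agent
who held at most as many items as `i` when the item arrived. -/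
theorem exists_countsBefore_le_of_blProb_pos {k m : ℕ} {b : Fin k → Fin m → Bool}
    {A : Fin m → Option (Fin k)} (hA : 0 < blProb b A) {i : Fin k} {j : Fin m}
    (hij : b i j = true) :
    ∃ l, A j = some l ∧ countsBefore A j l ≤ countsBefore A j i := by
  have hi : i ∈ bidders (fun i => b i j) := by simp [bidders, hij]
  have hj : blStep (fun i => b i j) (countsBefore A j) (A j) ≠ 0 :=
    Finset.prod_ne_zero_iff.mp hA.ne' j (Finset.mem_univ j)
  cases h : A j with
  | none => simp [h, blStep, Finset.ne_empty_of_mem hi] at hj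
  | some l =>
    simp only [h, blStep] at hj
    have hl := (ite_ne_right_iff.mp hj).1
    exact ⟨l, rfl, (Finset.mem_filter.mp hl).2 i hi⟩

/-- In an allocation of positive probability, any agent receives at most one more of the items
that agent `i` bids for than the total number of items `i` receives. -/
theorem card_bid_and_allocated_le_of_blProb_pos {k m : ℕ} {b : Fin k → Fin m → Bool}
    {A : Fin m → Option (Fin k)} (hA : 0 < blProb b A) (i l : Fin k) :
    (Finset.univ.filter (fun j => b i j = true ∧ A j = some l)).card
      ≤ (Finset.univ.filter (fun j => A j = some i)).card + 1 := by
  set S := Finset.univ.filter (fun j => b i j = true ∧ A j = some l)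
  rcases S.eq_empty_or_nonempty with h | h
  · simp [h]
  obtain ⟨j, hmem, hmax⟩ : ∃ j ∈ S, ∀ j' ∈ S, j' ≤ j := S.exists_max_image id h
  obtain ⟨hij, hjl⟩ := (Finset.mem_filter.mp hmem).2
  obtain ⟨l', hl', hle⟩ := exists_countsBefore_le_of_blProb_pos hA hij
  obtain rfl : l = l' := Option.some_injective _ (hjl.symm.trans hl')
  have hsub : S ⊆ insert j (Finset.univ.filter (fun j' => j' < j ∧ A j' = some l)) := by
    intro j' hj'
    rcases (hmax j' hj').eq_or_lt with h | h
    · simp [h]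
    · simp [h, (Finset.mem_filter.mp hj').2.2]
  calc S.card ≤ countsBefore A j l + 1 := (Finset.card_le_card hsub).trans (card_insert_le _ _)
    _ ≤ countsBefore A j i + 1 := by gcongr
    _ ≤ _ := by
      unfold countsBefore
      gcongr with j'
      exact And.right

/-- Under the Balanced Like mechanism with `k` agents, in every allocation of positive
probability each agent `i` receives at least `⌊t_i / k⌋` items, where `t_i` is the
number of items agent `i` bids for. -/
theorem balancedLike_guarantee (k m : ℕ) (b : Fin k → Fin m → Bool)
    (A : Fin m → Option (Fin k)) (hA : 0 < blProb b A) (i : Fin k) :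
    (Finset.univ.filter (fun j => b i j = true)).card / k
      ≤ (Finset.univ.filter (fun j => A j = some i)).card := by
  set r := (Finset.univ.filter (fun j => A j = some i)).card
  let S (l : Fin k) := Finset.univ.filter (fun j => b i j = true ∧ A j = some l)
  have hcover : Finset.univ.filter (fun j => b i j = true) ⊆ Finset.univ.biUnion S := by
    intro j hj
    have hij := (Finset.mem_filter.mp hj).2
    obtain ⟨l, hl, -⟩ := exists_countsBefore_le_of_blProb_pos hA hij
    simp [S, hij, hl]
  have hi : (S i).card < r + 1 :=
    Nat.lt_succ_of_le (Finset.card_le_card (Finset.monotone_filter_right _ fun _ _ h => h.2))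
  refine Nat.lt_succ_iff.mp (Nat.div_lt_of_lt_mul ?_)
  calc _ ≤ (Finset.univ.biUnion S).card := Finset.card_le_card hcover
    _ ≤ ∑ l, (S l).card := Finset.card_biUnion_le
    _ < ∑ _l : Fin k, (r + 1) := Finset.sum_lt_sum
      (fun l _ => card_bid_and_allocated_le_of_blProb_pos hA i l) ⟨i, Finset.mem_univ i, hi⟩
    _ = k * (r + 1) := by simp
end

section
/- With k agents, the Like mechanism is k-competitive from both an egalitarian and a utilitarian perspective: for every instance with nonnegative utilities, (i) for every allocation A, the egalitarian welfare of A is at most k times the ex ante egalitarian welfare of the Like mechanism under sincere bidding, and (ii) for every allocation A, the utilitarian welfare of A is at most k times the ex ante utilitarian welfare of the Like mechanism under sincere bidding. -/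
open Finset

/-- No allocation gives an agent more than `k` times the expected utility the agent gets
from the Like mechanism under sincere bidding. -/
lemma bundleUtil_le_mul_likeEU_sincere {k m : ℕ} (u : Fin k → Fin m → ℚ)
    (hu : ∀ i j, 0 ≤ u i j) (A : Fin m → Option (Fin k)) (i : Fin k) :
    bundleUtil u A i i ≤ k * likeEU u (sincere u) i := by
  unfold bundleUtil likeEU
  rw [Finset.mul_sum]
  refine Finset.sum_le_sum fun j _ => ?_
  rcases (hu i j).eq_or_lt with h | h
  · simp [← h]
  · have hb : sincere u i j = true := by simp [sincere, h]
    have hpos : (0 : ℚ) < likeQ (sincere u) j :=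
      Nat.cast_pos.mpr (Finset.card_pos.mpr ⟨i, by simp [hb]⟩)
    have hle : (likeQ (sincere u) j : ℚ) ≤ k := by
      exact_mod_cast (Finset.card_le_univ _).trans_eq (Fintype.card_fin k)
    calc (if A j = some i then u i j else 0) ≤ u i j := by split_ifs <;> simp [h.le]
      _ ≤ k * (u i j / likeQ (sincere u) j) := by
        rw [← mul_div_assoc, le_div_iff₀ hpos, mul_comm]
        exact mul_le_mul_of_nonneg_right hle h.le
      _ = k * (if sincere u i j then u i j / likeQ (sincere u) j else 0) := by simp [hb]

/-- With `k` agents, the Like mechanism is `k`-competitive from both the egalitarian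
and the utilitarian perspective: every allocation's egalitarian (resp. utilitarian)
welfare is at most `k` times the ex ante egalitarian (resp. utilitarian) welfare of
the Like mechanism under sincere bidding. -/
theorem like_k_competitive (k m : ℕ) (hk : 0 < k) (u : Fin k → Fin m → ℚ)
    (hu : ∀ i j, 0 ≤ u i j) :
    (∀ A : Fin m → Option (Fin k),
      egalAlloc hk u A ≤ k * minAgents hk (fun i => likeEU u (sincere u) i)) ∧
    (∀ A : Fin m → Option (Fin k),
      utilAlloc u A ≤ k * ∑ i, likeEU u (sincere u) i) := by
  refine ⟨fun A => ?_, fun A => ?_⟩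
  · obtain ⟨i, -, hi⟩ := Finset.exists_mem_eq_inf'
      (Finset.univ_nonempty_iff.mpr (Fin.pos_iff_nonempty.mp hk))
      (fun i => likeEU u (sincere u) i)
    unfold egalAlloc minAgents
    rw [hi]
    exact (Finset.inf'_le _ (Finset.mem_univ i)).trans
      (bundleUtil_le_mul_likeEU_sincere u hu A i)
  · unfold utilAlloc
    rw [Finset.mul_sum]
    exact Finset.sum_le_sum fun i _ => bundleUtil_le_mul_likeEU_sincere u hu A i
end

section
/- With 2 agents and general utilities, the Balanced Like mechanism is not c-competitive for any constant c, from either an egalitarian or a utilitarian perspective: for every rational c > 0 there is an instance with 2 agents and nonnegative utilities such that some allocation has egalitarian welfare greater than c times the ex ante egalitarian welfare of the Balanced Like mechanism under sincere bidding, and some allocation has utilitarian welfare greater than c times the ex ante utilitarian welfare of the Balanced Like mechanism under sincere bidding. -/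
open Finset

/-- The utilities of the lower-bound instance: agent `0` grabs the first item, so the second item,
which agent `0` values at `M ^ 2`, goes to agent `1`. -/
def trapUtil (M : ℚ) : Fin 2 → Fin 3 → ℚ :=
  ![![1, M ^ 2, 0], ![0, 1, M]]

/-- The sincere bids in `trapUtil M` for positive `M`. -/
def trapBids : Fin 2 → Fin 3 → Bool :=
  ![![true, true, false], ![false, true, true]]

lemma sincere_trapUtil {M : ℚ} (hM : 0 < M) : sincere (trapUtil M) = trapBids := by
  funext i j
  fin_cases i <;> fin_cases j <;> simp [sincere, trapUtil, trapBids, hM]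

/-- If exactly one bidder holds the fewest items, then the item goes to this bidder. -/
lemma blStep_eq_of_filter_eq_singleton {k : ℕ} {bid : Fin k → Bool} {cnt : Fin k → ℕ} {i : Fin k}
    (h : (bidders bid).filter (fun i0 => ∀ i' ∈ bidders bid, cnt i0 ≤ cnt i') = {i})
    (a : Option (Fin k)) : blStep bid cnt a = if a = some i then 1 else 0 := by
  cases a with
  | none =>
    have hne : bidders bid ≠ ∅ := by
      rintro h0
      simp [h0] at h
    simp [blStep, hne]
  | some a => simp [blStep, h]

/-- With the bids `trapBids`, the mechanism is deterministic. -/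
lemma blProb_trapBids (A : Fin 3 → Option (Fin 2)) :
    blProb trapBids A = if A = ![some 0, some 1, some 1] then 1 else 0 := by
  have h0 : blStep (fun i => trapBids i 0) (countsBefore A 0) (A 0) =
      if A 0 = some 0 then 1 else 0 := by
    refine blStep_eq_of_filter_eq_singleton ?_ _
    ext i
    fin_cases i <;> simp [bidders, trapBids]
  have h1 (hA : A 0 = some 0) : blStep (fun i => trapBids i 1) (countsBefore A 1) (A 1) =
      if A 1 = some 1 then 1 else 0 := by
    have hlt : countsBefore A 1 1 < countsBefore A 1 0 := by
      simp only [countsBefore, Finset.card_filter, Fin.sum_univ_three, hA]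
      simp
    refine blStep_eq_of_filter_eq_singleton ?_ _
    ext i
    fin_cases i <;> simp [bidders, trapBids, hlt, hlt.le]
  have h2 : blStep (fun i => trapBids i 2) (countsBefore A 2) (A 2) =
      if A 2 = some 1 then 1 else 0 := by
    refine blStep_eq_of_filter_eq_singleton ?_ _
    ext i
    fin_cases i <;> simp [bidders, trapBids]
  have hA : A = ![some 0, some 1, some 1] ↔ A 0 = some 0 ∧ A 1 = some 1 ∧ A 2 = some 1 := by
    simp [funext_iff, Fin.forall_fin_succ]
  rw [blProb, Fin.prod_univ_three, h0, h2]
  by_cases hA0 : A 0 = some 0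
  · rw [h1 hA0]
    simp [hA, hA0, ← ite_and, and_comm]
  · simp [hA, hA0]

lemma blEU_trapUtil {M : ℚ} (hM : 0 < M) (i : Fin 2) :
    blEU (trapUtil M) (sincere (trapUtil M)) i = ![1, 1 + M] i := by
  rw [blEU, sincere_trapUtil hM]
  simp only [blProb_trapBids, ite_mul, one_mul, zero_mul, Finset.sum_ite_eq', Finset.mem_univ,
    if_true]
  fin_cases i <;> simp [bundleUtil, trapUtil, Fin.sum_univ_three]

lemma bundleUtil_trapUtil (M : ℚ) (i : Fin 2) :
    bundleUtil (trapUtil M) ![some 0, some 0, some 1] i i = ![1 + M ^ 2, M] i := by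
  fin_cases i <;> simp [bundleUtil, trapUtil, Fin.sum_univ_three]

/-- With 2 agents and general nonnegative utilities, the Balanced Like mechanism is
not `c`-competitive for any constant `c > 0`, from either an egalitarian or a
utilitarian perspective. -/
theorem balancedLike_not_competitive :
    ∀ c : ℚ, 0 < c →
      ∃ (m : ℕ) (u : Fin 2 → Fin m → ℚ),
        (∀ i j, 0 ≤ u i j) ∧
        (∃ A : Fin m → Option (Fin 2),
          c * minAgents (by norm_num) (fun i => blEU u (sincere u) i)
            < egalAlloc (by norm_num) u A) ∧
        (∃ A : Fin m → Option (Fin 2),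
          c * (∑ i, blEU u (sincere u) i) < utilAlloc u A) := by
  intro c hc
  have hM : 0 < c + 2 := by linarith
  refine ⟨3, trapUtil (c + 2), fun i j => ?_, ⟨![some 0, some 0, some 1], ?_⟩,
    ⟨![some 0, some 0, some 1], ?_⟩⟩
  · fin_cases i <;> fin_cases j <;> simp [trapUtil] <;> positivity
  · simp only [egalAlloc, minAgents, blEU_trapUtil hM, bundleUtil_trapUtil]
    have hmin : (univ : Finset (Fin 2)).inf' univ_nonempty ![1, 1 + (c + 2)] ≤ 1 :=
      Finset.inf'_le (f := ![1, 1 + (c + 2)]) (mem_univ 0)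
    refine (mul_le_mul_of_nonneg_left hmin hc.le).trans_lt ?_
    simp only [Finset.lt_inf'_iff, mem_univ, forall_true_left, Fin.forall_fin_two]
    constructor
    · simp
      nlinarith
    · simp
  · simp only [utilAlloc, blEU_trapUtil hM, bundleUtil_trapUtil, Fin.sum_univ_two,
      Matrix.cons_val_zero, Matrix.cons_val_one]
    nlinarith
end

section
/- The price of anarchy of the Like mechanism with k agents is at most k for both egalitarian and utilitarian welfare: for every pure Nash equilibrium b of the Like mechanism, each agent i's expected utility under b is at least (1/k) times Σ_j u(i,j); consequently the ex ante egalitarian welfare under b is at least (1/k) times the maximum egalitarian welfare of any allocation, and the ex ante utilitarian welfare under b is at least (1/k) times the maximum utilitarian welfare of any allocation. -/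
open Finset

theorem likeQ_le {k m : ℕ} (b : Fin k → Fin m → Bool) (j : Fin m) : likeQ b j ≤ k :=
  (Finset.card_le_univ _).trans_eq (Fintype.card_fin k)

theorem likeQ_pos {k m : ℕ} {b : Fin k → Fin m → Bool} {i : Fin k} {j : Fin m}
    (h : b i j = true) : 0 < likeQ b j :=
  Finset.card_pos.mpr ⟨i, Finset.mem_filter.mpr ⟨Finset.mem_univ i, h⟩⟩

/-- An agent bidding for every item gets at least `1/k` of their total utility. -/
theorem sum_div_le_likeEU_of_forall_bid {k m : ℕ} {u : Fin k → Fin m → ℚ}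
    (hu : ∀ i j, 0 ≤ u i j) {b : Fin k → Fin m → Bool} {i : Fin k}
    (h : ∀ j, b i j = true) : (∑ j, u i j) / k ≤ likeEU u b i := by
  unfold likeEU
  rw [Finset.sum_div]
  refine Finset.sum_le_sum fun j _ => ?_
  rw [if_pos (h j)]
  exact div_le_div_of_nonneg_left (hu i j) (mod_cast likeQ_pos (h j)) (mod_cast likeQ_le b j)

theorem LikePNE.sum_div_le_likeEU {k m : ℕ} {u : Fin k → Fin m → ℚ}
    (hu : ∀ i j, 0 ≤ u i j) {b : Fin k → Fin m → Bool} (hb : LikePNE u b) (i : Fin k) :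
    (∑ j, u i j) / k ≤ likeEU u b i :=
  (sum_div_le_likeEU_of_forall_bid hu fun j => by simp).trans (hb i fun _ => true)

theorem bundleUtil_le_sum {k m : ℕ} {u : Fin k → Fin m → ℚ} (hu : ∀ i j, 0 ≤ u i j)
    (A : Fin m → Option (Fin k)) (i i' : Fin k) : bundleUtil u A i i' ≤ ∑ j, u i j := by
  refine Finset.sum_le_sum fun j _ => ?_
  split_ifs
  · exact le_rfl
  · exact hu i j

/-- The price of anarchy of the Like mechanism with `k` agents is at most `k` for both
egalitarian and utilitarian welfare: in every pure Nash equilibrium `b`, each agent's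
expected utility is at least `1/k` of their total utility; consequently the ex ante
egalitarian (resp. utilitarian) welfare under `b` is at least `1/k` of the egalitarian
(resp. utilitarian) welfare of any allocation. -/
theorem like_price_of_anarchy (k m : ℕ) (hk : 0 < k) (u : Fin k → Fin m → ℚ)
    (hu : ∀ i j, 0 ≤ u i j) (b : Fin k → Fin m → Bool) (hb : LikePNE u b) :
    (∀ i, (∑ j, u i j) / k ≤ likeEU u b i) ∧
    (∀ A : Fin m → Option (Fin k),
      egalAlloc hk u A / k ≤ minAgents hk (fun i => likeEU u b i)) ∧
    (∀ A : Fin m → Option (Fin k),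
      utilAlloc u A / k ≤ ∑ i, likeEU u b i) := by
  have key : ∀ (A : Fin m → Option (Fin k)) (i : Fin k),
      bundleUtil u A i i / k ≤ likeEU u b i := fun A i =>
    (div_le_div_of_nonneg_right (bundleUtil_le_sum hu A i i) k.cast_nonneg).trans
      (hb.sum_div_le_likeEU hu i)
  refine ⟨hb.sum_div_le_likeEU hu, fun A => ?_, fun A => ?_⟩
  · refine Finset.le_inf' _ _ fun i hi => le_trans ?_ (key A i)
    exact div_le_div_of_nonneg_right
      (Finset.inf'_le (fun i => bundleUtil u A i i) hi) k.cast_nonneg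
  · rw [utilAlloc, Finset.sum_div]
    exact Finset.sum_le_sum fun i _ => key A i
end
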